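/- arXiv:2504.21713 — 3 statements merged into one kernel-verified Lean document; each statement's English description precedes it below -/
import Mathlib

section
/- Let ω = exp(2πi/N) and let M_t be the 2×2 complex matrix with first row (ω + ω⁻¹ − 2, ω² + ω⁻² − 2) and second row (ω^p + ω^{−p} − 2, ω^{2p} + ω^{−2p} − 2). Then det(M_t) = 2·ω^{−(p+1)}·(ω − 1)²·(ω^p − 1)²·( cos(2pπ/N) − cos(2π/N) ). In particular, if N does not divide p, p − 1, or p + 1, then det(M_t) ≠ 0. -/
open Complex Finset

/-- The determinant of the matrix `!![f x, f (x ^ 2); f y, f (y ^ 2)]` with `f z = z + z⁻¹ - 2`. -/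
lemma det_add_inv_sub_two {K : Type*} [Field K] {x y : K} (hx : x ≠ 0) (hy : y ≠ 0) :
    (!![x + x⁻¹ - 2, x ^ 2 + (x ^ 2)⁻¹ - 2; y + y⁻¹ - 2, y ^ 2 + (y ^ 2)⁻¹ - 2]).det =
      (x * y)⁻¹ * (x - 1) ^ 2 * (y - 1) ^ 2 * (y + y⁻¹ - (x + x⁻¹)) := by
  rw [Matrix.det_fin_two_of]
  field_simp
  ring

/-- Euler's formula for `2 cos (2 p π / N)` in terms of the root of unity `exp (2 π i / N)`. -/
lemma exp_zpow_add_inv (p : ℤ) (N : ℕ) :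
    Complex.exp (2 * (Real.pi : ℂ) * Complex.I / (N : ℂ)) ^ p +
      (Complex.exp (2 * (Real.pi : ℂ) * Complex.I / (N : ℂ)) ^ p)⁻¹ =
      2 * (Real.cos (2 * (p : ℝ) * Real.pi / (N : ℝ)) : ℂ) := by
  rw [← Complex.exp_int_mul, ← Complex.exp_neg, Complex.ofReal_cos, Complex.two_cos]
  push_cast
  congr 2 <;> ring

/-- The determinant of the 2×2 coefficient matrix `M_t`, and its nonvanishing when
N divides none of p, p − 1, p + 1. -/
theorem det_Mt (p : ℤ) (hp0 : p ≠ 0) (hp1 : p ≠ 1) (hpm1 : p ≠ -1)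
    (N : ℕ) (hN : 4 ≤ N)
    (ω : ℂ) (hω : ω = Complex.exp (2 * (Real.pi : ℂ) * Complex.I / (N : ℂ)))
    (M : Matrix (Fin 2) (Fin 2) ℂ)
    (hM : M = !![ω + ω⁻¹ - 2, ω ^ 2 + ω ^ (-2 : ℤ) - 2;
                 ω ^ p + ω ^ (-p) - 2, ω ^ (2 * p) + ω ^ (-(2 * p)) - 2]) :
    M.det = 2 * ω ^ (-(p + 1)) * (ω - 1) ^ 2 * (ω ^ p - 1) ^ 2 *
        ((Real.cos (2 * (p : ℝ) * Real.pi / (N : ℝ)) -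
          Real.cos (2 * Real.pi / (N : ℝ)) : ℝ) : ℂ) ∧
      ((¬ (N : ℤ) ∣ p ∧ ¬ (N : ℤ) ∣ (p - 1) ∧ ¬ (N : ℤ) ∣ (p + 1)) → M.det ≠ 0) := by
  have hprim : IsPrimitiveRoot ω N := hω ▸ Complex.isPrimitiveRoot_exp N (by omega)
  have hω0 : ω ≠ 0 := hprim.ne_zero (by omega)
  have hy0 : ω ^ p ≠ 0 := zpow_ne_zero p hω0
  have hdet : M.det = (ω * ω ^ p)⁻¹ * (ω - 1) ^ 2 * (ω ^ p - 1) ^ 2 *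
      (ω ^ p + (ω ^ p)⁻¹ - (ω + ω⁻¹)) := by
    rw [← det_add_inv_sub_two hω0 hy0, hM, zpow_neg, zpow_neg, zpow_neg, mul_comm 2 p, zpow_mul]
    norm_cast
  refine ⟨?_, fun ⟨h0, hsub, hadd⟩ ↦ ?_⟩
  · have hcos := exp_zpow_add_inv p N
    have hcos_one := exp_zpow_add_inv 1 N
    rw [← hω] at hcos hcos_one
    rw [zpow_one, Int.cast_one, mul_one] at hcos_one
    rw [hdet, hcos, hcos_one, zpow_neg, zpow_add_one₀ hω0, Complex.ofReal_sub]
    ring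
  · have hω1 : ω - 1 ≠ 0 := sub_ne_zero.2 (hprim.ne_one (by omega))
    have hy1 : ω ^ p - 1 ≠ 0 := sub_ne_zero.2 (mt (hprim.zpow_eq_one_iff_dvd p).1 h0)
    have hsub1 : ω ^ (p - 1) - 1 ≠ 0 :=
      sub_ne_zero.2 (mt (hprim.zpow_eq_one_iff_dvd (p - 1)).1 hsub)
    have hadd1 : ω ^ (p + 1) - 1 ≠ 0 :=
      sub_ne_zero.2 (mt (hprim.zpow_eq_one_iff_dvd (p + 1)).1 hadd)
    have hfactor : ω ^ p + (ω ^ p)⁻¹ - (ω + ω⁻¹) =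
        (ω ^ p)⁻¹ * (ω ^ (p - 1) - 1) * (ω ^ (p + 1) - 1) := by
      rw [zpow_sub_one₀ hω0, zpow_add_one₀ hω0]
      field_simp
      ring
    rw [hdet, hfactor]
    simp [hω0, hy0, hω1, hy1, hsub1, hadd1]
end

section
/- Let N ≥ 3 be an odd integer and let p be an integer such that N does not divide p − 1 and N does not divide p + 1. Then cos(πp/N) ≠ 0 and cos(πp/N) + (−1)^p · cos(π/N) ≠ 0. -/
open Real

/-- For odd N ≥ 3 and p with N dividing neither p − 1 nor p + 1, both `cos(πp/N)` and
`cos(πp/N) + (−1)^p cos(π/N)` are nonzero. -/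
theorem cos_nonvanishing (N : ℕ) (hN : 3 ≤ N) (hNo : Odd N) (p : ℤ)
    (h1 : ¬ (N : ℤ) ∣ (p - 1)) (h2 : ¬ (N : ℤ) ∣ (p + 1)) :
    Real.cos (Real.pi * (p : ℝ) / (N : ℝ)) ≠ 0 ∧
      Real.cos (Real.pi * (p : ℝ) / (N : ℝ)) +
        (-1 : ℝ) ^ p * Real.cos (Real.pi / (N : ℝ)) ≠ 0 := by
  have hN0 : (N : ℝ) ≠ 0 := by
    have : N ≠ 0 := by lia
    exact_mod_cast this
  have hpi : Real.pi ≠ 0 := Real.pi_ne_zero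
  constructor
  · rw [Real.cos_ne_zero_iff]
    intro k hk
    have h : (p : ℝ) * 2 = (2 * k + 1) * N := by
      field_simp at hk
      linarith
    have h' : p * 2 = (2 * k + 1) * (N : ℤ) := by exact_mod_cast h
    obtain ⟨m, rfl⟩ := hNo
    push_cast at h'
    have : 2 * (p - k * (2 * m + 1) - m) = 1 := by linarith
    lia
  · intro h
    have hcos : Real.cos (Real.pi * p / N) =
        Real.cos (Real.pi / N + ((p + 1 : ℤ) : ℝ) * Real.pi) := by
      rw [Real.cos_add_int_mul_pi, zpow_add_one₀ (by norm_num)]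
      linarith
    obtain ⟨k, hk | hk⟩ := Real.cos_eq_cos_iff.mp hcos
    · have h : (1 : ℝ) + (p + 1) * N = 2 * k * N + p := by
        push_cast at hk
        field_simp at hk
        linarith
      have h' : 1 + (p + 1) * (N : ℤ) = 2 * k * N + p := by exact_mod_cast h
      exact h1 ⟨p + 1 - 2 * k, by linarith⟩
    · have h : (1 : ℝ) + (p + 1) * N = 2 * k * N - p := by
        push_cast at hk
        field_simp at hk
        linarith
      have h' : 1 + (p + 1) * (N : ℤ) = 2 * k * N - p := by exact_mod_cast h
      exact h2 ⟨2 * k - (p + 1), by linarith⟩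
end

section
/- If the N-body choreographic motion on the p-limaçon with parameters a, b has a collision — that is, there exist t ∈ ℝ and indices 0 ≤ k < k' ≤ N−1 with z(t + 2πk/N) = z(t + 2πk'/N) — then a/b = ε·sin(πpk₀/N)/sin(πk₀/N) for some ε ∈ {1, −1} and some integer k₀ with 1 ≤ k₀ ≤ N−1. Consequently, for fixed p and N, the set of ratios a/b for which the choreographic motion has a collision has at most 2(N−1) elements. -/
open Complex Finset

/-- The p-limaçon curve `z(t) = a e^{it} + b e^{ipt}` in the complex plane. -/
noncomputable def limacon (a b : ℝ) (p : ℤ) (t : ℝ) : ℂ :=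
  (a : ℂ) * Complex.exp ((t : ℂ) * Complex.I) +
    (b : ℂ) * Complex.exp ((p : ℂ) * (t : ℂ) * Complex.I)

/-- The k-th body of the N-body choreographic motion on the p-limaçon:
`z_k(t) = z(t + 2πk/N)`. -/
noncomputable def body (a b : ℝ) (p : ℤ) (N : ℕ) (k : ℤ) (t : ℝ) : ℂ :=
  limacon a b p (t + 2 * Real.pi * (k : ℝ) / (N : ℝ))

/-- The length of a chord of the unit circle. -/
theorem norm_exp_mul_I_sub_exp_mul_I (x y : ℝ) :
    ‖Complex.exp ((x : ℂ) * Complex.I) - Complex.exp ((y : ℂ) * Complex.I)‖ =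
      2 * |Real.sin ((y - x) / 2)| := by
  have h : Complex.exp ((x : ℂ) * Complex.I) - Complex.exp ((y : ℂ) * Complex.I) =
      -(Complex.exp ((x : ℂ) * Complex.I) *
        (Complex.exp (Complex.I * ((y - x : ℝ) : ℂ)) - 1)) := by
    rw [mul_sub, ← Complex.exp_add]
    push_cast
    ring_nf
  rw [h, norm_neg, norm_mul, Complex.norm_exp_ofReal_mul_I,
    Complex.norm_exp_I_mul_ofReal_sub_one, one_mul, norm_mul, Real.norm_eq_abs,
    Real.norm_eq_abs, abs_two]

/-- Two equal points of a limaçon yield chords of equal length on its two generating circles. -/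
theorem abs_mul_abs_sin_eq_of_limacon_eq {a b : ℝ} {p : ℤ} {s t : ℝ}
    (h : limacon a b p s = limacon a b p t) :
    |a| * |Real.sin ((t - s) / 2)| = |b| * |Real.sin (p * ((t - s) / 2))| := by
  unfold limacon at h
  have h₁ : (a : ℂ) * (Complex.exp ((s : ℂ) * Complex.I) - Complex.exp ((t : ℂ) * Complex.I)) =
      -((b : ℂ) * (Complex.exp (((p * s : ℝ) : ℂ) * Complex.I) -
        Complex.exp (((p * t : ℝ) : ℂ) * Complex.I))) := by
    push_cast
    linear_combination h
  have h₂ := congrArg norm h₁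
  rw [norm_neg, norm_mul, norm_mul, norm_exp_mul_I_sub_exp_mul_I,
    norm_exp_mul_I_sub_exp_mul_I, Complex.norm_real, Complex.norm_real, Real.norm_eq_abs,
    Real.norm_eq_abs, show ((p : ℝ) * t - p * s) / 2 = p * ((t - s) / 2) by ring] at h₂
  linarith

theorem div_eq_of_limacon_collision {p : ℤ} {N : ℕ} {a b : ℝ} (hb : b ≠ 0)
    (h : ∃ t : ℝ, ∃ k k' : ℕ, k < k' ∧ k' ≤ N - 1 ∧
      limacon a b p (t + 2 * Real.pi * (k : ℝ) / (N : ℝ)) =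
        limacon a b p (t + 2 * Real.pi * (k' : ℝ) / (N : ℝ))) :
    ∃ ε : ℝ, (ε = 1 ∨ ε = -1) ∧ ∃ k₀ : ℕ, 1 ≤ k₀ ∧ k₀ ≤ N - 1 ∧
      a / b = ε * Real.sin (Real.pi * (p : ℝ) * (k₀ : ℝ) / (N : ℝ)) /
        Real.sin (Real.pi * (k₀ : ℝ) / (N : ℝ)) := by
  obtain ⟨t, k, k', hk, hk', h⟩ := h
  have hN : (0 : ℝ) < N := by exact_mod_cast (by omega : 0 < N)
  have hchord := abs_mul_abs_sin_eq_of_limacon_eq h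
  have hcast : ((k' - k : ℕ) : ℝ) = k' - k := Nat.cast_sub hk.le
  have hangle : (t + 2 * Real.pi * (k' : ℝ) / (N : ℝ) - (t + 2 * Real.pi * (k : ℝ) / (N : ℝ))) / 2 =
      Real.pi * ((k' - k : ℕ) : ℝ) / (N : ℝ) := by
    rw [hcast]
    ring
  have hangle' : (p : ℝ) * (Real.pi * ((k' - k : ℕ) : ℝ) / (N : ℝ)) =
      Real.pi * (p : ℝ) * ((k' - k : ℕ) : ℝ) / (N : ℝ) := by ring
  rw [hangle, hangle', ← abs_mul, ← abs_mul] at hchord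
  have hpos : 0 < Real.sin (Real.pi * ((k' - k : ℕ) : ℝ) / (N : ℝ)) := by
    have hk₀ : (0 : ℝ) < ((k' - k : ℕ) : ℝ) := by exact_mod_cast (by omega : 0 < k' - k)
    have hk₁ : ((k' - k : ℕ) : ℝ) < N := by exact_mod_cast (by omega : k' - k < N)
    apply Real.sin_pos_of_pos_of_lt_pi
    · positivity
    · rw [div_lt_iff₀ hN]
      exact mul_lt_mul_of_pos_left hk₁ Real.pi_pos
  rcases abs_eq_abs.mp hchord with h' | h'
  · refine ⟨1, Or.inl rfl, k' - k, by omega, by omega, ?_⟩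
    rw [div_eq_div_iff hb hpos.ne']
    linarith
  · refine ⟨-1, Or.inr rfl, k' - k, by omega, by omega, ?_⟩
    rw [div_eq_div_iff hb hpos.ne']
    linarith

/-- If a collision occurs, then `a/b = ± sin(πpk₀/N)/sin(πk₀/N)` for some
`1 ≤ k₀ ≤ N−1`; hence at most `2(N−1)` values of `a/b` lead to collisions. -/
theorem collision_ratio (p : ℤ) (hp0 : p ≠ 0) (hp1 : p ≠ 1) (hpm1 : p ≠ -1)
    (N : ℕ) (hN : 4 ≤ N) :
    (∀ a b : ℝ, a ≠ 0 → b ≠ 0 →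
      (∃ t : ℝ, ∃ k k' : ℕ, k < k' ∧ k' ≤ N - 1 ∧
        limacon a b p (t + 2 * Real.pi * (k : ℝ) / (N : ℝ)) =
          limacon a b p (t + 2 * Real.pi * (k' : ℝ) / (N : ℝ))) →
      ∃ ε : ℝ, (ε = 1 ∨ ε = -1) ∧ ∃ k₀ : ℕ, 1 ≤ k₀ ∧ k₀ ≤ N - 1 ∧
        a / b = ε * Real.sin (Real.pi * (p : ℝ) * (k₀ : ℝ) / (N : ℝ)) /
          Real.sin (Real.pi * (k₀ : ℝ) / (N : ℝ))) ∧
    ({r : ℝ | ∃ a b : ℝ, a ≠ 0 ∧ b ≠ 0 ∧ r = a / b ∧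
        ∃ t : ℝ, ∃ k k' : ℕ, k < k' ∧ k' ≤ N - 1 ∧
          limacon a b p (t + 2 * Real.pi * (k : ℝ) / (N : ℝ)) =
            limacon a b p (t + 2 * Real.pi * (k' : ℝ) / (N : ℝ))}.Finite ∧
      {r : ℝ | ∃ a b : ℝ, a ≠ 0 ∧ b ≠ 0 ∧ r = a / b ∧
        ∃ t : ℝ, ∃ k k' : ℕ, k < k' ∧ k' ≤ N - 1 ∧
          limacon a b p (t + 2 * Real.pi * (k : ℝ) / (N : ℝ)) =
            limacon a b p (t + 2 * Real.pi * (k' : ℝ) / (N : ℝ))}.ncard ≤ 2 * (N - 1)) := by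
  refine ⟨fun a b _ hb h => div_eq_of_limacon_collision hb h, ?_⟩
  let F : Finset ℝ := (({1, -1} : Finset ℝ) ×ˢ Finset.Icc 1 (N - 1)).image fun q : ℝ × ℕ =>
    q.1 * Real.sin (Real.pi * (p : ℝ) * (q.2 : ℝ) / (N : ℝ)) /
      Real.sin (Real.pi * (q.2 : ℝ) / (N : ℝ))
  have hF : F.card ≤ 2 * (N - 1) := by
    refine Finset.card_image_le.trans ?_
    rw [Finset.card_product, Nat.card_Icc]
    exact Nat.mul_le_mul Finset.card_le_two (by omega)
  have hsub : {r : ℝ | ∃ a b : ℝ, a ≠ 0 ∧ b ≠ 0 ∧ r = a / b ∧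
      ∃ t : ℝ, ∃ k k' : ℕ, k < k' ∧ k' ≤ N - 1 ∧
        limacon a b p (t + 2 * Real.pi * (k : ℝ) / (N : ℝ)) =
          limacon a b p (t + 2 * Real.pi * (k' : ℝ) / (N : ℝ))} ⊆ (F : Set ℝ) := by
    rintro r ⟨a, b, -, hb, rfl, h⟩
    obtain ⟨ε, hε, k₀, h₁, h₂, heq⟩ := div_eq_of_limacon_collision hb h
    exact Finset.mem_coe.mpr (Finset.mem_image.mpr ⟨(ε, k₀), by simp [hε, h₁, h₂], heq.symm⟩)
  refine ⟨F.finite_toSet.subset hsub, (Set.ncard_le_ncard hsub F.finite_toSet).trans ?_⟩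
  rwa [Set.ncard_coe_finset]
end
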